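/- arXiv:1911.13046 — 2 statements merged into one kernel-verified Lean document; each statement's English description precedes it below -/
import Mathlib

section
/- Assume μ* − 2 min_{[p0,0]} B > 0 and that the size condition d + p0/(μ* − 2 min_{[p0,0]} B)^{1/2} < 0 holds. Then there exist μ > μ* and a continuous nonnegative solution H : [p0,0] → [0,∞) of the fixed-point equation (FPE) for μ satisfying H(0) = d. (Consequently H is differentiable with H' > 0 on [p0,0], H(p0) = 0, and H(0) = d, i.e., H is a laminar flow solution.) -/
open MeasureTheory Set

/-- The primitive `B(p) = ∫_{p0}^p β`. -/
noncomputable def Bfun (p0 : ℝ) (β : ℝ → ℝ) (p : ℝ) : ℝ := ∫ s in p0..p, β s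

/-- The constant `μ* = 2 (g d ∫_{p0}^0 |ρ'| + max_{[p0,0]} B)`. -/
noncomputable def muStar (p0 d g : ℝ) (ρ' β : ℝ → ℝ) : ℝ :=
  2 * (g * d * (∫ s in p0..(0:ℝ), |ρ' s|) + sSup (Bfun p0 β '' Set.Icc p0 0))

/-- The integrand of the fixed-point equation:
`(μ − 2 ∫_{p0}^r [g ρ'(s)(H(s) − d) + β(s)] ds)^{−1/2}`. -/
noncomputable def fpeDeriv (p0 d g μ : ℝ) (ρ' β H : ℝ → ℝ) (r : ℝ) : ℝ :=
  (Real.sqrt (μ - 2 * ∫ s in p0..r, (g * ρ' s * (H s - d) + β s)))⁻¹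

/-- A continuous nonnegative function `H` on `[p0,0]` solving the fixed-point equation (FPE)
for the parameter `μ`. -/
def IsFPESolution (p0 d g μ : ℝ) (ρ' β H : ℝ → ℝ) : Prop :=
  ContinuousOn H (Set.Icc p0 0) ∧ (∀ p ∈ Set.Icc p0 (0:ℝ), 0 ≤ H p) ∧
  ∀ p ∈ Set.Icc p0 (0:ℝ), H p = ∫ r in p0..p, fpeDeriv p0 d g μ ρ' β H r

/-- The truncated function `x ↦ (max x ε)^{-1/2}` is globally Lipschitz. -/
theorem abs_inv_sqrt_max_sub_le {ε : ℝ} (hε : 0 < ε) (x y : ℝ) :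
    |(√(max x ε))⁻¹ - (√(max y ε))⁻¹| ≤ ((√ε) ^ 3)⁻¹ * |x - y| := by
  have he : 0 < √ε := Real.sqrt_pos.2 hε
  have hs : √ε ≤ √(max x ε) := Real.sqrt_le_sqrt (le_max_right _ _)
  have ht : √ε ≤ √(max y ε) := Real.sqrt_le_sqrt (le_max_right _ _)
  have hs2 : √(max x ε) ^ 2 = max x ε := Real.sq_sqrt (hε.le.trans (le_max_right _ _))
  have ht2 : √(max y ε) ^ 2 = max y ε := Real.sq_sqrt (hε.le.trans (le_max_right _ _))
  have hxy : |max x ε - max y ε| ≤ |x - y| := abs_max_sub_max_le_abs x y ε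
  rw [← hs2, ← ht2] at hxy
  generalize √(max x ε) = s at *
  generalize √(max y ε) = t at *
  generalize √ε = e at *
  have hs0 : 0 < s := he.trans_le hs
  have ht0 : 0 < t := he.trans_le ht
  have h1 : |s - t| * e ≤ |x - y| := by
    calc |s - t| * e ≤ |s - t| * (s + t) := by gcongr; linarith
      _ = |s ^ 2 - t ^ 2| := by
        rw [show s ^ 2 - t ^ 2 = (s - t) * (s + t) by ring, abs_mul,
          abs_of_pos (add_pos hs0 ht0)]
      _ ≤ |x - y| := hxy
  have h2 : |s⁻¹ - t⁻¹| = |s - t| * (s * t)⁻¹ := by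
    rw [inv_sub_inv hs0.ne' ht0.ne', abs_div, abs_sub_comm, abs_of_pos (mul_pos hs0 ht0),
      div_eq_mul_inv]
  calc |s⁻¹ - t⁻¹| = |s - t| * (s * t)⁻¹ := h2
    _ ≤ |s - t| * (e * e)⁻¹ := by gcongr
    _ = (e ^ 3)⁻¹ * (|s - t| * e) := by field_simp
    _ ≤ (e ^ 3)⁻¹ * |x - y| := by gcongr

/-- Volterra-type equations `u(p) = ∫_a^p φ(μ + ∫_a^r (k u + f))` with `φ` Lipschitz and `k`, `f`
integrable are solvable, with solutions depending continuously on `μ`. -/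
theorem exists_continuous_family_volterra {a b L : ℝ} (hab : a ≤ b) (hL : 0 ≤ L)
    {φ k f : ℝ → ℝ} (hφ : ∀ x y, |φ x - φ y| ≤ L * |x - y|)
    (hk : ∀ c d, IntervalIntegrable k volume c d)
    (hf : ∀ c d, IntervalIntegrable f volume c d) :
    ∃ u : ℝ → ℝ → ℝ, (∀ μ, Continuous (u μ)) ∧
      (∀ μ, ∀ p ∈ Icc a b, u μ p = ∫ r in a..p, φ (μ + ∫ s in a..r, (k s * u μ s + f s))) ∧
      Continuous fun μ => u μ b := by
  have hφc : Continuous φ :=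
    (LipschitzWith.of_dist_le_mul (K := ⟨L, hL⟩) fun x y => hφ x y).continuous
  set M : ℝ := ∫ s in a..b, |k s|
  have hM : 0 ≤ M := intervalIntegral.integral_nonneg hab fun _ _ => abs_nonneg _
  set K : ℝ := 2 * (L * M + 1)
  have hK : 0 < K := by positivity
  have hKL : L * M / K ≤ 1 / 2 := by
    rw [div_le_div_iff₀ hK two_pos]; simp only [K]; linarith
  let w : C(Icc a b, ℝ) → ℝ → ℝ := fun G s => Real.exp (K * s) * IccExtend hab G s
  have hw : ∀ G, Continuous (w G) := fun G => by
    have := G.continuous.Icc_extend' (h := hab)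
    simp only [w]; fun_prop
  have hi : ∀ G c d, IntervalIntegrable (fun s => k s * w G s + f s) volume c d :=
    fun G c d => ((hk c d).mul_continuousOn (hw G).continuousOn).add (hf c d)
  let Ψ : ℝ → C(Icc a b, ℝ) → ℝ → ℝ := fun μ G r =>
    φ (μ + ∫ s in a..r, (k s * w G s + f s))
  have hΨ : ∀ μ G, Continuous (Ψ μ G) := fun μ G =>
    hφc.comp (continuous_const.add (intervalIntegral.continuous_primitive (hi G) a))
  have hΨi : ∀ μ G c d, IntervalIntegrable (Ψ μ G) volume c d := fun μ G c d =>
    (hΨ μ G).intervalIntegrable c d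
  have hT : ∀ μ G, Continuous fun p => Real.exp (-(K * p)) * ∫ r in a..p, Ψ μ G r := fun μ G => by
    have := intervalIntegral.continuous_primitive (hΨi μ G) a
    fun_prop
  let T : ℝ → C(Icc a b, ℝ) → C(Icc a b, ℝ) := fun μ G =>
    ⟨fun p => Real.exp (-(K * p)) * ∫ r in a..p, Ψ μ G r, (hT μ G).comp continuous_subtype_val⟩
  have hTdiff : ∀ μ ν G₁ G₂ (p : Icc a b) (c : ℝ → ℝ), Continuous c →
      (∀ r ∈ Icc a b, |Ψ μ G₁ r - Ψ ν G₂ r| ≤ c r) →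
      |T μ G₁ p - T ν G₂ p| ≤ Real.exp (-(K * p)) * ∫ r in a..p, c r := by
    intro μ ν G₁ G₂ p c hc h
    have : T μ G₁ p - T ν G₂ p = Real.exp (-(K * p)) * ∫ r in a..p, (Ψ μ G₁ r - Ψ ν G₂ r) := by
      rw [intervalIntegral.integral_sub (hΨi _ _ _ _) (hΨi _ _ _ _)]
      simp only [T, ContinuousMap.coe_mk]; ring
    rw [this, abs_mul, Real.abs_exp]
    gcongr
    rw [← Real.norm_eq_abs]
    refine intervalIntegral.norm_integral_le_of_norm_le p.2.1 ?_ (hc.intervalIntegrable _ _)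
    exact Filter.Eventually.of_forall fun r hr => h r ⟨hr.1.le, hr.2.trans p.2.2⟩
  have hcontr : ∀ μ, ContractingWith (1 / 2) (T μ) := by
    intro μ
    refine ⟨by norm_num, LipschitzWith.of_dist_le_mul fun G₁ G₂ => ?_⟩
    rw [ContinuousMap.dist_le (by positivity)]
    intro p
    rw [Real.dist_eq]
    set D := dist G₁ G₂
    have hinner : ∀ r ∈ Icc a b, |Ψ μ G₁ r - Ψ μ G₂ r| ≤ L * (M * (Real.exp (K * r) * D)) := by
      intro r hr
      refine (hφ _ _).trans ?_
      gcongr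
      rw [add_sub_add_left_eq_sub, ← intervalIntegral.integral_sub (hi _ _ _) (hi _ _ _)]
      have hle : |∫ s in a..r, (k s * w G₁ s + f s - (k s * w G₂ s + f s))| ≤
          ∫ s in a..r, |k s| * (Real.exp (K * r) * D) := by
        rw [← Real.norm_eq_abs]
        refine intervalIntegral.norm_integral_le_of_norm_le hr.1 ?_ ((hk a r).abs.mul_const _)
        refine Filter.Eventually.of_forall fun s hs => ?_
        have h1 : k s * w G₁ s + f s - (k s * w G₂ s + f s) =
            k s * (Real.exp (K * s) * (IccExtend hab G₁ s - IccExtend hab G₂ s)) := by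
          simp only [w]; ring
        rw [h1, Real.norm_eq_abs, abs_mul, abs_mul, Real.abs_exp]
        have h2 : |IccExtend hab G₁ s - IccExtend hab G₂ s| ≤ D := by
          simp only [IccExtend, Function.comp_apply]
          exact (Real.dist_eq _ _).symm.trans_le
            (ContinuousMap.dist_apply_le_dist (f := G₁) (g := G₂) _)
        have := hs.2
        gcongr
      refine hle.trans ?_
      rw [intervalIntegral.integral_mul_const]
      gcongr
      exact intervalIntegral.integral_mono_interval le_rfl hr.1 hr.2
        (Filter.Eventually.of_forall fun _ => abs_nonneg _) (hk a b).abs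
    refine (hTdiff μ μ G₁ G₂ p _ (by fun_prop) hinner).trans ?_
    have hexp : ∫ r in a..p, Real.exp (K * r) ≤ Real.exp (K * p) / K := by
      rw [intervalIntegral.integral_comp_mul_left (f := Real.exp) hK.ne', integral_exp,
        smul_eq_mul, div_eq_inv_mul]
      gcongr
      linarith [Real.exp_pos (K * a)]
    have hD : 0 ≤ D := dist_nonneg
    have : ∫ r in a..p, L * (M * (Real.exp (K * r) * D)) =
        L * M * D * ∫ r in a..p, Real.exp (K * r) := by
      rw [← intervalIntegral.integral_const_mul]
      congr 1; ext r; ring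
    rw [this]
    calc Real.exp (-(K * p)) * (L * M * D * ∫ r in a..p, Real.exp (K * r))
        ≤ Real.exp (-(K * p)) * (L * M * D * (Real.exp (K * p) / K)) := by gcongr
      _ = L * M / K * D := by rw [Real.exp_neg]; field_simp
      _ ≤ 1 / 2 * D := by gcongr
      _ = _ := by norm_num
  have : Nonempty (C(Icc a b, ℝ)) := ⟨0⟩
  let G : ℝ → C(Icc a b, ℝ) := fun μ => (hcontr μ).fixedPoint (T μ)
  have hG : ∀ μ, T μ (G μ) = G μ := fun μ => (hcontr μ).fixedPoint_isFixedPt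
  have hGc : Continuous G := by
    have hb : 0 ≤ b - a := sub_nonneg.2 hab
    set C : ℝ := Real.exp (-(K * a)) * ((b - a) * L)
    refine (LipschitzWith.of_dist_le_mul (K := ⟨2 * C, by positivity⟩) fun μ ν => ?_).continuous
    have := (hcontr μ).fixedPoint_lipschitz_in_map (hcontr ν) (C := C * dist μ ν) fun F => by
      rw [ContinuousMap.dist_le (by positivity)]
      intro p
      rw [Real.dist_eq, Real.dist_eq]
      refine (hTdiff μ ν F F p (fun _ => L * |μ - ν|) continuous_const fun r _ => ?_).trans ?_
      · refine (hφ _ _).trans_eq ?_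
        rw [add_sub_add_right_eq_sub]
      · rw [intervalIntegral.integral_const, smul_eq_mul]
        have h1 := p.2.1
        have h2 := p.2.2
        calc Real.exp (-(K * p)) * ((p - a) * (L * |μ - ν|))
            ≤ Real.exp (-(K * a)) * ((b - a) * (L * |μ - ν|)) := by gcongr
          _ = _ := by simp only [C]; ring
    refine this.trans_eq ?_
    change C * dist μ ν / (1 - ↑(1 / 2 : NNReal)) = 2 * C * dist μ ν
    simp only [NNReal.coe_div, NNReal.coe_one, NNReal.coe_ofNat]
    ring
  refine ⟨fun μ => w (G μ), fun μ => hw _, fun μ p hp => ?_, ?_⟩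
  · have h := congrArg (fun F : C(Icc a b, ℝ) => F ⟨p, hp⟩) (hG μ)
    simp only [T, ContinuousMap.coe_mk] at h
    simp only [w, IccExtend_of_mem hab _ hp] at h ⊢
    rw [← h, ← mul_assoc, ← Real.exp_add, add_neg_cancel, Real.exp_zero, one_mul]
  · simp only [w, IccExtend_right]
    exact continuous_const.mul ((ContinuousEvalConst.continuous_eval_const _).comp hGc)

/-- `B` is continuous on `[p0,0]`. -/
theorem continuousOn_Bfun {p0 : ℝ} {β : ℝ → ℝ} (hβint : IntegrableOn β (Icc p0 0)) :
    ContinuousOn (Bfun p0 β) (Icc p0 0) := by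
  rcases le_total p0 0 with h | h
  · have := intervalIntegral.continuousOn_primitive_interval (a := p0) (b := 0) (f := β)
      (μ := volume) (by rwa [uIcc_of_le h])
    rwa [uIcc_of_le h] at this
  · exact (subsingleton_Icc_of_ge h).continuousOn _

/-- The radicand of (FPE) is at least `μ - μ*` for every nonnegative height function. -/
theorem sub_muStar_le_radicand {p0 d g μ : ℝ} {ρ' β H : ℝ → ℝ} (hd : 0 < d) (hg : 0 < g)
    (hρint : IntegrableOn ρ' (Icc p0 0))
    (hρneg : ∀ᵐ s ∂(volume.restrict (Icc p0 (0 : ℝ))), ρ' s ≤ 0)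
    (hβint : IntegrableOn β (Icc p0 0)) (hH : Continuous H)
    (hH0 : ∀ p ∈ Icc p0 (0 : ℝ), 0 ≤ H p) {r : ℝ} (hr : r ∈ Icc p0 (0 : ℝ)) :
    μ - muStar p0 d g ρ' β ≤ μ - 2 * ∫ s in p0..r, (g * ρ' s * (H s - d) + β s) := by
  have hsub : Icc p0 r ⊆ Icc p0 0 := Icc_subset_Icc_right hr.2
  have hρi : IntervalIntegrable ρ' volume p0 r :=
    (intervalIntegrable_iff_integrableOn_Icc_of_le hr.1).2 (hρint.mono_set hsub)
  have hβi : IntervalIntegrable β volume p0 r :=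
    (intervalIntegrable_iff_integrableOn_Icc_of_le hr.1).2 (hβint.mono_set hsub)
  have hρ0 : IntervalIntegrable ρ' volume p0 0 :=
    (intervalIntegrable_iff_integrableOn_Icc_of_le (hr.1.trans hr.2)).2 hρint
  have hi : IntervalIntegrable (fun s => g * ρ' s * (H s - d)) volume p0 r :=
    (hρi.const_mul g).mul_continuousOn (hH.sub continuous_const).continuousOn
  rw [intervalIntegral.integral_add hi hβi]
  have h1 : ∫ s in p0..r, g * ρ' s * (H s - d) ≤ ∫ s in p0..r, g * d * |ρ' s| := by
    refine intervalIntegral.integral_mono_ae_restrict hr.1 hi (hρi.abs.const_mul _) ?_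
    filter_upwards [ae_restrict_of_ae_restrict_of_subset hsub hρneg,
      ae_restrict_mem measurableSet_Icc] with s hs hs'
    rw [abs_of_nonpos hs]
    nlinarith [mul_nonneg hg.le (mul_nonneg (neg_nonneg.2 hs) (hH0 s (hsub hs')))]
  have h2 : ∫ s in p0..r, |ρ' s| ≤ ∫ s in p0..(0 : ℝ), |ρ' s| :=
    intervalIntegral.integral_mono_interval le_rfl hr.1 hr.2
      (Filter.Eventually.of_forall fun _ => abs_nonneg _) hρ0.abs
  have h3 : ∫ s in p0..r, β s ≤ sSup (Bfun p0 β '' Icc p0 0) :=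
    le_csSup (isCompact_Icc.bddAbove_image (continuousOn_Bfun hβint)) ⟨r, hr, rfl⟩
  rw [intervalIntegral.integral_const_mul] at h1
  have h4 := mul_le_mul_of_nonneg_left h2 (mul_pos hg hd).le
  unfold muStar
  linarith

/-- The radicand of (FPE) is at most `μ - 2 min B` for every height function bounded by `d`. -/
theorem radicand_le_sub_sInf {p0 d g μ : ℝ} {ρ' β H : ℝ → ℝ} (hg : 0 < g)
    (hρint : IntegrableOn ρ' (Icc p0 0))
    (hρneg : ∀ᵐ s ∂(volume.restrict (Icc p0 (0 : ℝ))), ρ' s ≤ 0)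
    (hβint : IntegrableOn β (Icc p0 0)) (hH : Continuous H)
    (hHd : ∀ p ∈ Icc p0 (0 : ℝ), H p ≤ d) {r : ℝ} (hr : r ∈ Icc p0 (0 : ℝ)) :
    μ - 2 * ∫ s in p0..r, (g * ρ' s * (H s - d) + β s) ≤
      μ - 2 * sInf (Bfun p0 β '' Icc p0 0) := by
  have hsub : Icc p0 r ⊆ Icc p0 0 := Icc_subset_Icc_right hr.2
  have hρi : IntervalIntegrable ρ' volume p0 r :=
    (intervalIntegrable_iff_integrableOn_Icc_of_le hr.1).2 (hρint.mono_set hsub)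
  have hβi : IntervalIntegrable β volume p0 r :=
    (intervalIntegrable_iff_integrableOn_Icc_of_le hr.1).2 (hβint.mono_set hsub)
  have hi : IntervalIntegrable (fun s => g * ρ' s * (H s - d)) volume p0 r :=
    (hρi.const_mul g).mul_continuousOn (hH.sub continuous_const).continuousOn
  rw [intervalIntegral.integral_add hi hβi]
  have h1 : 0 ≤ ∫ s in p0..r, g * ρ' s * (H s - d) := by
    refine intervalIntegral.integral_nonneg_of_ae_restrict hr.1 ?_
    filter_upwards [ae_restrict_of_ae_restrict_of_subset hsub hρneg,
      ae_restrict_mem measurableSet_Icc] with s hs hs'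
    exact mul_nonneg_of_nonpos_of_nonpos (mul_nonpos_of_nonneg_of_nonpos hg.le hs)
      (sub_nonpos.2 (hHd s (hsub hs')))
  have h3 : sInf (Bfun p0 β '' Icc p0 0) ≤ ∫ s in p0..r, β s :=
    csInf_le (isCompact_Icc.bddBelow_image (continuousOn_Bfun hβint)) ⟨r, hr, rfl⟩
  linarith

/-- For every `μ₁ > μ*` the equation (FPE) has solutions for all `μ ≥ μ₁`, and these can be chosen
so that their value at `0` depends continuously on `μ`. -/
theorem exists_continuous_family_isFPESolution {p0 d g μ₁ : ℝ} {ρ' β : ℝ → ℝ}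
    (hp0 : p0 < 0) (hd : 0 < d) (hg : 0 < g)
    (hρint : IntegrableOn ρ' (Icc p0 0))
    (hρneg : ∀ᵐ s ∂(volume.restrict (Icc p0 (0 : ℝ))), ρ' s ≤ 0)
    (hβint : IntegrableOn β (Icc p0 0)) (hμ₁ : muStar p0 d g ρ' β < μ₁) :
    ∃ u : ℝ → ℝ → ℝ, (∀ μ, Continuous (u μ)) ∧ (Continuous fun μ => u μ 0) ∧
      ∀ μ, μ₁ ≤ μ → IsFPESolution p0 d g μ ρ' β (u μ) ∧
        ContinuousOn (fpeDeriv p0 d g μ ρ' β (u μ)) (Icc p0 0) := by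
  set ε := μ₁ - muStar p0 d g ρ' β with hε_def
  have hε : 0 < ε := sub_pos.2 hμ₁
  set k : ℝ → ℝ := (Icc p0 0).indicator fun s => -2 * (g * ρ' s)
  set f : ℝ → ℝ := (Icc p0 0).indicator fun s => 2 * (g * d * ρ' s) - 2 * β s
  have hk : Integrable k :=
    (integrable_indicator_iff measurableSet_Icc).2 ((hρint.const_mul g).const_mul (-2))
  have hf : Integrable f := (integrable_indicator_iff measurableSet_Icc).2
    (((hρint.const_mul (g * d)).const_mul 2).sub (hβint.const_mul 2))
  set φ : ℝ → ℝ := fun x => (√(max x ε))⁻¹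
  have hφpos : ∀ x, 0 < φ x := fun x =>
    inv_pos.2 (Real.sqrt_pos.2 (hε.trans_le (le_max_right _ _)))
  obtain ⟨u, hu, hueq, hu0⟩ := exists_continuous_family_volterra (a := p0) (b := 0)
    (L := ((√ε) ^ 3)⁻¹) hp0.le (by positivity) (abs_inv_sqrt_max_sub_le hε)
    (fun _ _ => hk.intervalIntegrable) (fun _ _ => hf.intervalIntegrable)
  have hnonneg : ∀ μ, ∀ p ∈ Icc p0 (0 : ℝ), 0 ≤ u μ p := fun μ p hp => by
    rw [hueq μ p hp]
    exact intervalIntegral.integral_nonneg hp.1 fun r _ => (hφpos _).le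
  have hφc : Continuous φ := by
    have : ∀ x : ℝ, √(max x ε) ≠ 0 := fun x => (inv_pos.1 (hφpos x)).ne'
    simp only [φ]
    fun_prop (disch := assumption)
  have hrad : ∀ μ, μ₁ ≤ μ → ∀ r ∈ Icc p0 (0 : ℝ),
      fpeDeriv p0 d g μ ρ' β (u μ) r = φ (μ + ∫ s in p0..r, (k s * u μ s + f s)) := by
    intro μ hμ r hr
    have hle := sub_muStar_le_radicand (μ := μ) hd hg hρint hρneg hβint (hu μ) (hnonneg μ) hr
    have hint : ∫ s in p0..r, (k s * u μ s + f s) =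
        -2 * ∫ s in p0..r, (g * ρ' s * (u μ s - d) + β s) := by
      rw [← intervalIntegral.integral_const_mul]
      refine intervalIntegral.integral_congr fun s hs => ?_
      rw [uIcc_of_le hr.1] at hs
      have hs' : s ∈ Icc p0 (0 : ℝ) := ⟨hs.1, hs.2.trans hr.2⟩
      simp only [k, f, indicator_of_mem hs']
      ring
    rw [hint]
    have hmax : max (μ + -2 * ∫ s in p0..r, (g * ρ' s * (u μ s - d) + β s)) ε =
        μ - 2 * ∫ s in p0..r, (g * ρ' s * (u μ s - d) + β s) := by
      rw [max_eq_left] <;> linarith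
    simp only [φ, fpeDeriv, hmax]
  refine ⟨u, hu, hu0, fun μ hμ => ⟨⟨(hu μ).continuousOn, hnonneg μ, fun p hp => ?_⟩, ?_⟩⟩
  · rw [hueq μ p hp]
    refine intervalIntegral.integral_congr fun r hr => ?_
    rw [uIcc_of_le hp.1] at hr
    exact (hrad μ hμ r ⟨hr.1, hr.2.trans hp.2⟩).symm
  · refine ContinuousOn.congr (Continuous.continuousOn ?_) (hrad μ hμ)
    refine hφc.comp (continuous_const.add
      (intervalIntegral.continuous_primitive (fun c d => ?_) p0))
    exact (hk.intervalIntegrable.mul_continuousOn (hu μ).continuousOn).add hf.intervalIntegrable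

/-- under the size condition `d + p0/(μ* − 2 min_{[p0,0]} B)^{1/2} < 0` there exist
`μ > μ*` and a continuous nonnegative solution `H` of the (FPE) for `μ` with `H(0) = d`;
consequently `H` is differentiable with `H' > 0`, `H(p0) = 0` and `H(0) = d`, i.e. a laminar
flow solution exists. -/
theorem laminar_flow_solution_exists
    (p0 d g : ℝ) (ρ' β : ℝ → ℝ)
    (hp0 : p0 < 0) (hd : 0 < d) (hg : 0 < g)
    (hρint : IntegrableOn ρ' (Set.Icc p0 0))
    (hρneg : ∀ᵐ s ∂(volume.restrict (Set.Icc p0 (0:ℝ))), ρ' s ≤ 0)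
    (hβint : IntegrableOn β (Set.Icc p0 0))
    (hmin : 0 < muStar p0 d g ρ' β - 2 * sInf (Bfun p0 β '' Set.Icc p0 0))
    (hsize : d + p0 / Real.sqrt (muStar p0 d g ρ' β - 2 * sInf (Bfun p0 β '' Set.Icc p0 0)) < 0) :
    ∃ μ : ℝ, muStar p0 d g ρ' β < μ ∧
      ∃ H : ℝ → ℝ, IsFPESolution p0 d g μ ρ' β H ∧ H 0 = d ∧ H p0 = 0 ∧
        ∀ p ∈ Set.Icc p0 (0:ℝ),
          HasDerivWithinAt H (fpeDeriv p0 d g μ ρ' β H p) (Set.Icc p0 0) p ∧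
            0 < fpeDeriv p0 d g μ ρ' β H p := by
  obtain ⟨μ₁, hμ₁, hsize₁⟩ : ∃ μ₁ > muStar p0 d g ρ' β,
      d + p0 / √(μ₁ - 2 * sInf (Bfun p0 β '' Icc p0 0)) < 0 := by
    have hc : ContinuousAt (fun μ : ℝ => d + p0 / √(μ - 2 * sInf (Bfun p0 β '' Icc p0 0)))
        (muStar p0 d g ρ' β) := by
      have := (Real.sqrt_pos.2 hmin).ne'
      fun_prop (disch := assumption)
    have hev := (hc.eventually_lt continuousAt_const hsize).filter_mono
      (nhdsWithin_le_nhds (s := Ioi (muStar p0 d g ρ' β)))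
    obtain ⟨μ, h1, h2⟩ := (hev.and self_mem_nhdsWithin).exists
    exact ⟨μ, h2, h1⟩
  obtain ⟨u, hu, hu0, hsol⟩ :=
    exists_continuous_family_isFPESolution hp0 hd hg hρint hρneg hβint hμ₁
  have h0 : (0 : ℝ) ∈ Icc p0 0 := ⟨hp0.le, le_rfl⟩
  have hint : ∀ μ, μ₁ ≤ μ →
      IntervalIntegrable (fpeDeriv p0 d g μ ρ' β (u μ)) volume p0 0 := fun μ hμ =>
    ContinuousOn.intervalIntegrable_of_Icc hp0.le (hsol μ hμ).2
  have hradpos : ∀ μ, μ₁ ≤ μ → ∀ r ∈ Icc p0 (0 : ℝ), μ - muStar p0 d g ρ' β ≤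
      μ - 2 * ∫ s in p0..r, (g * ρ' s * (u μ s - d) + β s) := fun μ hμ r hr =>
    sub_muStar_le_radicand hd hg hρint hρneg hβint (hu μ) (hsol μ hμ).1.2.1 hr
  have hpos : ∀ μ, μ₁ ≤ μ → ∀ r ∈ Icc p0 (0 : ℝ), 0 < fpeDeriv p0 d g μ ρ' β (u μ) r :=
    fun μ hμ r hr => inv_pos.2 (Real.sqrt_pos.2
      ((sub_pos.2 (hμ₁.trans_le hμ)).trans_le (hradpos μ hμ r hr)))
  have hlow : d ≤ u μ₁ 0 := by
    by_contra! hlt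
    have hle : ∀ p ∈ Icc p0 (0 : ℝ), u μ₁ p ≤ d := by
      intro p hp
      refine le_trans ?_ hlt.le
      rw [(hsol μ₁ le_rfl).1.2.2 p hp, (hsol μ₁ le_rfl).1.2.2 0 h0]
      refine intervalIntegral.integral_mono_interval le_rfl hp.1 hp.2 ?_ (hint μ₁ le_rfl)
      filter_upwards [ae_restrict_mem measurableSet_Ioc] with r hr
      exact (hpos μ₁ le_rfl r ⟨hr.1.le, hr.2⟩).le
    have hge : ∫ _ in p0..(0 : ℝ), (√(μ₁ - 2 * sInf (Bfun p0 β '' Icc p0 0)))⁻¹ ≤ u μ₁ 0 := by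
      rw [(hsol μ₁ le_rfl).1.2.2 0 h0]
      refine intervalIntegral.integral_mono_on hp0.le (by simp) (hint μ₁ le_rfl) fun r hr => ?_
      exact inv_anti₀ (inv_pos.1 (hpos μ₁ le_rfl r hr))
        (Real.sqrt_le_sqrt (radicand_le_sub_sInf hg hρint hρneg hβint (hu μ₁) hle hr))
    rw [intervalIntegral.integral_const, smul_eq_mul, zero_sub] at hge
    rw [div_eq_mul_inv] at hsize₁
    linarith
  set μ₂ := max μ₁ (muStar p0 d g ρ' β + (-p0 / d) ^ 2)
  have hμ₂ : μ₁ ≤ μ₂ := le_max_left _ _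
  have hup : u μ₂ 0 ≤ d := by
    have hq : 0 < -p0 / d := div_pos (neg_pos.2 hp0) hd
    have hle : u μ₂ 0 ≤ ∫ _ in p0..(0 : ℝ), (-p0 / d)⁻¹ := by
      rw [(hsol μ₂ hμ₂).1.2.2 0 h0]
      refine intervalIntegral.integral_mono_on hp0.le (hint μ₂ hμ₂) (by simp) fun r hr => ?_
      refine inv_anti₀ hq (Real.le_sqrt_of_sq_le (le_trans ?_ (hradpos μ₂ hμ₂ r hr)))
      linarith [le_max_right μ₁ (muStar p0 d g ρ' β + (-p0 / d) ^ 2)]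
    refine hle.trans_eq ?_
    rw [intervalIntegral.integral_const, smul_eq_mul, inv_div, zero_sub,
      mul_div_cancel₀ _ (neg_pos.2 hp0).ne']
  obtain ⟨μ, hμ, hμd⟩ := intermediate_value_Icc' hμ₂ hu0.continuousOn ⟨hup, hlow⟩
  refine ⟨μ, hμ₁.trans_le hμ.1, u μ, (hsol μ hμ.1).1, hμd, ?_, fun p hp => ⟨?_, hpos μ hμ.1 p hp⟩⟩
  · rw [(hsol μ hμ.1).1.2.2 p0 ⟨le_rfl, hp0.le⟩, intervalIntegral.integral_same]
  · have : Fact (p ∈ Icc p0 (0 : ℝ)) := ⟨hp⟩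
    refine HasDerivWithinAt.congr_of_mem ?_ (hsol μ hμ.1).1.2.2 hp
    refine intervalIntegral.integral_hasDerivWithinAt_right ((hint μ hμ.1).mono_set ?_)
      ((hsol μ hμ.1).2.stronglyMeasurableAtFilter_nhdsWithin measurableSet_Icc p)
      ((hsol μ hμ.1).2 p hp)
    rw [uIcc_of_le hp.1, uIcc_of_le hp0.le]
    exact Icc_subset_Icc_right hp.2
end

section
/- Assume in addition that ρ̄ is nonincreasing on [p0,0] and that e^{2A(0)} − 2A(0) ≤ 5, and let λ > 0 and σ > 0 be fixed. For each θ ∈ ℝ let (w_θ, z_θ) denote the (unique) solution of the system S(λ,θ) on [p0,0] with w_θ(p0) = 0 and z_θ(p0) = a(p0)³. Then σ θ w_θ(0) − λ² z_θ(0) → ∞ as θ → ∞; that is, for every M ∈ ℝ there exists θ₀ such that σ θ w_θ(0) − λ² z_θ(0) > M for all θ ≥ θ₀. -/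
open MeasureTheory Set

/-- `A(p) = ∫_{p0}^p g ρ̄(s)/a(s)³ ds`. -/
noncomputable def Afun (p0 g : ℝ) (a ρ : ℝ → ℝ) (p : ℝ) : ℝ :=
  ∫ s in p0..p, g * ρ s / (a s) ^ 3

/-- A pair of differentiable functions `(w,z)` on `[p0,0]` solving the first-order system
`S(λ,θ)`: `w' = (gρ̄/a³)w + z/a³` and `z' = (θa/λ² − g²ρ̄²/a³)w − (gρ̄/a³)z`. -/
def IsSolS (p0 g lam θ : ℝ) (a ρ w z : ℝ → ℝ) : Prop :=
  ∀ p ∈ Set.Icc p0 (0:ℝ),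
    HasDerivWithinAt w (g * ρ p / (a p) ^ 3 * w p + z p / (a p) ^ 3) (Set.Icc p0 0) p ∧
    HasDerivWithinAt z ((θ * a p / lam ^ 2 - g ^ 2 * (ρ p) ^ 2 / (a p) ^ 3) * w p
      - g * ρ p / (a p) ^ 3 * z p) (Set.Icc p0 0) p

/-- A function with nonnegative derivative on `[x, y]` is monotone there. -/
lemma monotoneOn_Icc_of_hasDerivWithinAt_nonneg {x y : ℝ} {f f' : ℝ → ℝ}
    (hf : ∀ p ∈ Icc x y, HasDerivWithinAt f (f' p) (Icc x y) p)
    (hf' : ∀ p ∈ Icc x y, 0 ≤ f' p) : MonotoneOn f (Icc x y) :=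
  monotoneOn_of_hasDerivWithinAt_nonneg (convex_Icc x y)
    (fun p hp => (hf p hp).continuousWithinAt)
    (fun p hp => (hf p (interior_subset hp)).mono interior_subset)
    (fun p hp => hf' p (interior_subset hp))

section PlanarSystem

variable {x y k : ℝ} {b m q w z : ℝ → ℝ}

/-- For `w' = b w + m z`, `z' = q w - b z` with `m, q ≥ 0`, the product `w z` is nondecreasing,
hence nonnegative when `w` vanishes at the left endpoint. -/
lemma mul_nonneg_of_planar_system
    (hw : ∀ p ∈ Icc x y, HasDerivWithinAt w (b p * w p + m p * z p) (Icc x y) p)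
    (hz : ∀ p ∈ Icc x y, HasDerivWithinAt z (q p * w p - b p * z p) (Icc x y) p)
    (hm : ∀ p ∈ Icc x y, 0 ≤ m p) (hq : ∀ p ∈ Icc x y, 0 ≤ q p) (hw0 : w x = 0) :
    ∀ p ∈ Icc x y, 0 ≤ w p * z p := by
  intro p hp
  have hmono := monotoneOn_Icc_of_hasDerivWithinAt_nonneg
    (fun r hr => (hw r hr).mul (hz r hr)) (fun r hr => by
      have h1 := mul_nonneg (hm r hr) (sq_nonneg (z r))
      have h2 := mul_nonneg (hq r hr) (sq_nonneg (w r))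
      nlinarith)
  simpa [hw0] using hmono (left_mem_Icc.2 (hp.1.trans hp.2)) hp hp.1

/-- Solutions of the planar system that start on the positive `z`-axis stay in the closed first
quadrant, and `z + k w` stays above its initial value as soon as `b ≤ k m`. -/
lemma nonneg_of_planar_system
    (hw : ∀ p ∈ Icc x y, HasDerivWithinAt w (b p * w p + m p * z p) (Icc x y) p)
    (hz : ∀ p ∈ Icc x y, HasDerivWithinAt z (q p * w p - b p * z p) (Icc x y) p)
    (hm : ∀ p ∈ Icc x y, 0 ≤ m p) (hq : ∀ p ∈ Icc x y, 0 ≤ q p)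
    (hb : ∀ p ∈ Icc x y, 0 ≤ b p) (hk : 0 < k) (hbk : ∀ p ∈ Icc x y, b p ≤ k * m p)
    (hw0 : w x = 0) (hz0 : 0 < z x) :
    ∀ p ∈ Icc x y, 0 ≤ w p ∧ 0 ≤ z p ∧ z x ≤ z p + k * w p := by
  have hwz := mul_nonneg_of_planar_system hw hz hm hq hw0
  have hder : ∀ p ∈ Icc x y, HasDerivWithinAt (fun r => z r + k * w r)
      (q p * w p - b p * z p + k * (b p * w p + m p * z p)) (Icc x y) p :=
    fun p hp => (hz p hp).add ((hw p hp).const_mul k)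
  have hcont : ContinuousOn (fun r => z r + k * w r) (Icc x y) :=
    fun p hp => (hder p hp).continuousWithinAt
  have hmono := monotoneOn_Icc_of_hasDerivWithinAt_nonneg
    (fun r hr => (hder r hr).mul (hder r hr)) (fun r hr => by
      have h1 := mul_nonneg (hq r hr) (hwz r hr)
      have h2 := mul_nonneg (mul_nonneg hk.le (hb r hr)) (hwz r hr)
      have h3 := mul_nonneg (sub_nonneg.2 (hbk r hr)) (sq_nonneg (z r))
      have h4 := mul_nonneg (mul_nonneg hk.le (hq r hr)) (sq_nonneg (w r))
      have h5 := mul_nonneg (mul_nonneg (sq_nonneg k) (hb r hr)) (sq_nonneg (w r))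
      have h6 := mul_nonneg (mul_nonneg hk.le (sub_nonneg.2 (hbk r hr))) (hwz r hr)
      nlinarith)
  have hsq : ∀ p ∈ Icc x y, z x * z x ≤ (z p + k * w p) * (z p + k * w p) := by
    intro p hp
    simpa [hw0] using hmono (left_mem_Icc.2 (hp.1.trans hp.2)) hp hp.1
  have hpos : ∀ p ∈ Icc x y, 0 < z p + k * w p := by
    intro p hp
    by_contra! hneg
    have hx : x ∈ Icc x y := left_mem_Icc.2 (hp.1.trans hp.2)
    obtain ⟨r, hr, hr0⟩ := isPreconnected_Icc.intermediate_value hp hx hcont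
      (show (0 : ℝ) ∈ Icc _ _ from ⟨hneg, by simpa [hw0] using hz0.le⟩)
    have h1 := hsq r hr
    simp only at hr0
    rw [hr0] at h1
    nlinarith
  intro p hp
  have h0 := hpos p hp
  have h1 := hwz p hp
  refine ⟨?_, ?_, abs_le_of_sq_le_sq' (by nlinarith [hsq p hp]) h0.le |>.2⟩
  · by_contra! h
    nlinarith [mul_pos_of_neg_of_neg h h]
  · by_contra! h
    nlinarith [mul_pos_of_neg_of_neg h h]

/-- An energy estimate: `z ≤ R w + z x` when `q ≤ R² m`. -/
lemma le_of_planar_system {R : ℝ}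
    (hw : ∀ p ∈ Icc x y, HasDerivWithinAt w (b p * w p + m p * z p) (Icc x y) p)
    (hz : ∀ p ∈ Icc x y, HasDerivWithinAt z (q p * w p - b p * z p) (Icc x y) p)
    (hb : ∀ p ∈ Icc x y, 0 ≤ b p) (hR : 0 ≤ R) (hqR : ∀ p ∈ Icc x y, q p ≤ R ^ 2 * m p)
    (hw0 : w x = 0) (hz0 : 0 ≤ z x) (hwnn : ∀ p ∈ Icc x y, 0 ≤ w p)
    (hznn : ∀ p ∈ Icc x y, 0 ≤ z p) :
    ∀ p ∈ Icc x y, z p ≤ R * w p + z x := by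
  intro p hp
  have hmono := monotoneOn_Icc_of_hasDerivWithinAt_nonneg
    (fun r hr => (((hw r hr).mul (hw r hr)).const_mul (R ^ 2)).sub ((hz r hr).mul (hz r hr)))
    (fun r hr => by
      have h1 := mul_nonneg (sub_nonneg.2 (hqR r hr)) (mul_nonneg (hwnn r hr) (hznn r hr))
      have h2 := mul_nonneg (hb r hr) (sq_nonneg (z r))
      have h3 := mul_nonneg (mul_nonneg (sq_nonneg R) (hb r hr)) (sq_nonneg (w r))
      nlinarith)
  have h := hmono (left_mem_Icc.2 (hp.1.trans hp.2)) hp hp.1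
  simp only [Pi.sub_apply, Pi.mul_apply, hw0] at h
  have hRw := mul_nonneg hR (hwnn p hp)
  exact (abs_le_of_sq_le_sq' (by nlinarith [mul_nonneg hRw hz0]) (add_nonneg hRw hz0)).2

/-- A lower bound for `w` at the right endpoint that does not involve `q`. -/
lemma lower_bound_of_planar_system {c : ℝ} (hxy : x ≤ y)
    (hw : ∀ p ∈ Icc x y, HasDerivWithinAt w (b p * w p + m p * z p) (Icc x y) p)
    (hc : 0 ≤ c) (hcm : ∀ p ∈ Icc x y, c ≤ m p) (hcb : ∀ p ∈ Icc x y, c * k ≤ b p)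
    (hw0 : w x = 0)
    (hnn : ∀ p ∈ Icc x y, 0 ≤ w p ∧ 0 ≤ z p ∧ z x ≤ z p + k * w p) :
    c * z x * (y - x) ≤ w y := by
  have hmono := monotoneOn_Icc_of_hasDerivWithinAt_nonneg
    (fun r hr => (hw r hr).sub ((hasDerivWithinAt_id r (Icc x y)).const_mul (c * z x)))
    (fun r hr => by
      obtain ⟨h1, h2, h3⟩ := hnn r hr
      have h4 := mul_nonneg (sub_nonneg.2 (hcm r hr)) h2
      have h5 := mul_nonneg (sub_nonneg.2 (hcb r hr)) h1
      have h6 := mul_nonneg hc (sub_nonneg.2 h3)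
      nlinarith)
  have h := hmono (left_mem_Icc.2 hxy) (right_mem_Icc.2 hxy) hxy
  simp only [Pi.sub_apply, id, hw0] at h
  linarith

end PlanarSystem

/-- if `ρ̄` is nonincreasing and `e^{2A(0)} − 2A(0) ≤ 5`, and for each `θ` the
pair `(w_θ, z_θ)` solves `S(λ,θ)` with `w_θ(p0) = 0`, `z_θ(p0) = a(p0)³`, then the Wronskian
value `σ θ w_θ(0) − λ² z_θ(0)` tends to `∞` as `θ → ∞`. -/
theorem wronskian_tendsto_atTop
    (p0 g lam σ : ℝ) (hp0 : p0 < 0) (hg : 0 < g) (hlam : 0 < lam) (hσ : 0 < σ)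
    (a ρ : ℝ → ℝ)
    (ha : ContinuousOn a (Set.Icc p0 0)) (hapos : ∀ p ∈ Set.Icc p0 (0:ℝ), 0 < a p)
    (hρc : ContinuousOn ρ (Set.Icc p0 0)) (hρpos : ∀ p ∈ Set.Icc p0 (0:ℝ), 0 < ρ p)
    (hρmono : AntitoneOn ρ (Set.Icc p0 0))
    (hA : Real.exp (2 * Afun p0 g a ρ 0) - 2 * Afun p0 g a ρ 0 ≤ 5)
    (w z : ℝ → ℝ → ℝ)
    (hs : ∀ θ : ℝ, IsSolS p0 g lam θ a ρ (w θ) (z θ) ∧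
      w θ p0 = 0 ∧ z θ p0 = (a p0) ^ 3) :
    Filter.Tendsto (fun θ : ℝ => σ * θ * w θ 0 - lam ^ 2 * z θ 0)
      Filter.atTop Filter.atTop := by
  have hl : p0 ∈ Icc p0 (0:ℝ) := left_mem_Icc.2 hp0.le
  have hr : (0:ℝ) ∈ Icc p0 (0:ℝ) := right_mem_Icc.2 hp0.le
  obtain ⟨pn, hpn, hmin⟩ := isCompact_Icc.exists_isMinOn ⟨p0, hl⟩ ha
  obtain ⟨pN, hpN, hmax⟩ := isCompact_Icc.exists_isMaxOn ⟨p0, hl⟩ ha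
  have hn := hapos pn hpn
  have hN := hapos pN hpN
  have han : ∀ p ∈ Icc p0 (0:ℝ), a pn ≤ a p := fun p hp => hmin hp
  have haN : ∀ p ∈ Icc p0 (0:ℝ), a p ≤ a pN := fun p hp => hmax hp
  generalize a pn = n at *
  generalize a pN = N at *
  have hz0 : 0 < a p0 ^ 3 := pow_pos (hapos p0 hl) 3
  have hρl := hρpos p0 hl
  have hρr := hρpos 0 hr
  have hρle : ∀ p ∈ Icc p0 (0:ℝ), ρ p ≤ ρ p0 := fun p hp => hρmono hl hp hp.1
  have hρge : ∀ p ∈ Icc p0 (0:ℝ), ρ 0 ≤ ρ p := fun p hp => hρmono hp hr hp.2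
  set k := g * ρ p0 with hk
  have hkpos : 0 < k := mul_pos hg hρl
  set c := ρ 0 / ρ p0 * (1 / N ^ 3) with hc
  have hcpos : 0 < c := by positivity
  set c₁ := c * a p0 ^ 3 * (0 - p0) with hc₁
  have hc₁pos : 0 < c₁ := mul_pos (mul_pos hcpos hz0) (by linarith)
  have hcm : ∀ p ∈ Icc p0 (0:ℝ), c ≤ 1 / a p ^ 3 := fun p hp => by
    have hap := hapos p hp
    have h1 : 1 / N ^ 3 ≤ 1 / a p ^ 3 :=
      one_div_le_one_div_of_le (by positivity) (pow_le_pow_left₀ hap.le (haN p hp) 3)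
    have h2 : ρ 0 / ρ p0 ≤ 1 := (div_le_one hρl).2 (hρle 0 hr)
    exact (mul_le_of_le_one_left (by positivity) h2).trans h1
  have hcb : ∀ p ∈ Icc p0 (0:ℝ), c * k ≤ g * ρ p / a p ^ 3 := fun p hp => by
    have hap := hapos p hp
    have h1 : c * k = g * ρ 0 / N ^ 3 := by
      rw [hc, hk]; field_simp
    rw [h1]
    have h3 := hρpos p hp
    have h4 := hρge p hp
    have h5 := haN p hp
    gcongr
  have hlow : Filter.Tendsto (fun θ : ℝ => c₁ * √θ - lam ^ 2 * a p0 ^ 3)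
      Filter.atTop Filter.atTop :=
    Filter.tendsto_atTop_add_const_right _ _
      (Real.tendsto_sqrt_atTop.const_mul_atTop hc₁pos)
  refine Filter.tendsto_atTop_mono' _ ?_ hlow
  filter_upwards [Filter.eventually_ge_atTop (0:ℝ),
    Filter.eventually_ge_atTop (lam ^ 2 * k ^ 2 / n ^ 4),
    Real.tendsto_sqrt_atTop.eventually_ge_atTop ((lam * N ^ 2 + 1) / σ)] with θ hθ hθq hθσ
  obtain ⟨hsol, hw0, hzθ⟩ := hs θ
  have hw : ∀ p ∈ Icc p0 (0:ℝ), HasDerivWithinAt (w θ)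
      (g * ρ p / a p ^ 3 * w θ p + 1 / a p ^ 3 * z θ p) (Icc p0 0) p := fun p hp => by
    convert (hsol p hp).1 using 1
    ring
  have hz := fun p hp => (hsol p hp).2
  have hm : ∀ p ∈ Icc p0 (0:ℝ), 0 ≤ 1 / a p ^ 3 := fun p hp => hcpos.le.trans (hcm p hp)
  have hb : ∀ p ∈ Icc p0 (0:ℝ), 0 ≤ g * ρ p / a p ^ 3 :=
    fun p hp => (mul_pos hcpos hkpos).le.trans (hcb p hp)
  have hbk : ∀ p ∈ Icc p0 (0:ℝ), g * ρ p / a p ^ 3 ≤ k * (1 / a p ^ 3) := fun p hp => by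
    have hap := hapos p hp
    have h := hρle p hp
    rw [mul_one_div, hk]
    gcongr
  have hq : ∀ p ∈ Icc p0 (0:ℝ),
      0 ≤ θ * a p / lam ^ 2 - g ^ 2 * ρ p ^ 2 / a p ^ 3 := fun p hp => by
    have hap := hapos p hp
    have h1 : (g * ρ p) ^ 2 ≤ k ^ 2 :=
      pow_le_pow_left₀ (mul_pos hg (hρpos p hp)).le
        (mul_le_mul_of_nonneg_left (hρle p hp) hg.le) 2
    have h2 : lam ^ 2 * k ^ 2 ≤ θ * a p ^ 4 :=
      ((div_le_iff₀ (by positivity)).1 hθq).trans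
        (mul_le_mul_of_nonneg_left (pow_le_pow_left₀ hn.le (han p hp) 4) hθ)
    rw [sub_nonneg, div_le_div_iff₀ (by positivity) (by positivity)]
    nlinarith [mul_le_mul_of_nonneg_left h1 (sq_nonneg lam)]
  have hqR : ∀ p ∈ Icc p0 (0:ℝ), θ * a p / lam ^ 2 - g ^ 2 * ρ p ^ 2 / a p ^ 3
      ≤ (N ^ 2 / lam * √θ) ^ 2 * (1 / a p ^ 3) := fun p hp => by
    have hap := hapos p hp
    have h1 : 0 ≤ g ^ 2 * ρ p ^ 2 / a p ^ 3 := by positivity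
    have h2 : θ * a p / lam ^ 2 ≤ (N ^ 2 / lam * √θ) ^ 2 * (1 / a p ^ 3) := by
      rw [mul_pow, Real.sq_sqrt hθ, div_pow, ← pow_mul]
      have h3 : θ * a p / lam ^ 2 = a p ^ 4 / lam ^ 2 * θ * (1 / a p ^ 3) := by field_simp
      rw [h3]
      have h4 := haN p hp
      norm_num
      gcongr
    linarith
  have hnn := nonneg_of_planar_system hw hz hm hq hb hkpos hbk hw0 (hzθ ▸ hz0)
  have hup := le_of_planar_system hw hz hb (R := N ^ 2 / lam * √θ) (by positivity) hqR hw0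
    (hzθ ▸ hz0.le) (fun p hp => (hnn p hp).1) (fun p hp => (hnn p hp).2.1) 0 hr
  have hwlow := lower_bound_of_planar_system hp0.le hw hcpos.le hcm hcb hw0 hnn
  rw [hzθ] at hup hwlow
  have hup' : lam ^ 2 * z θ 0 ≤ lam * N ^ 2 * √θ * w θ 0 + lam ^ 2 * a p0 ^ 3 := by
    calc lam ^ 2 * z θ 0 ≤ lam ^ 2 * (N ^ 2 / lam * √θ * w θ 0 + a p0 ^ 3) := by gcongr
      _ = _ := by field_simp
  have hσθ : lam * N ^ 2 + 1 ≤ √θ * σ := (div_le_iff₀ hσ).1 hθσ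
  have hθs := Real.mul_self_sqrt hθ
  have hmain : √θ * w θ 0 ≤ σ * θ * w θ 0 - lam * N ^ 2 * √θ * w θ 0 := by
    have h := mul_le_mul_of_nonneg_right hσθ
      (mul_nonneg (Real.sqrt_nonneg θ) (hnn 0 hr).1)
    have h' : √θ * σ * (√θ * w θ 0) = σ * θ * w θ 0 := by
      linear_combination σ * w θ 0 * hθs
    linarith
  have hfin := mul_le_mul_of_nonneg_left hwlow (Real.sqrt_nonneg θ)
  linarith
end
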